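/- arXiv:1907.00091 — 2 statements merged into one kernel-verified Lean document; each statement's English description precedes it below -/
import Mathlib

section
/- Let s : ℝ → ℝ be differentiable on [-1,1] with continuous derivative s', let ρ̃ : ℝ → ℝ be continuous on [-1,1], let f : ℝ → ℝ be differentiable on [-1,1] with f' = ρ̃, and let x, y ∈ ℝ be such that (x - x̃)² + (y - s(x̃))² ≠ 0 for all x̃ ∈ [-1,1]. Then ∫_{-1}^{1} (1/2)·log((x - x̃)² + (y - s(x̃))²)·ρ̃(x̃) dx̃ = (1/2)·log((x - 1)² + (y - s(1))²)·f(1) - (1/2)·log((x + 1)² + (y - s(-1))²)·f(-1) + ∫_{-1}^{1} f(x̃)·[(x - x̃) + (y - s(x̃))·s'(x̃)] / [(x - x̃)² + (y - s(x̃))²] dx̃. -/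
open MeasureTheory

/-- Integration-by-parts decomposition of the Laplace single layer
potential, with `f` an antiderivative of the density `ρ̃`. -/
theorem slp_integration_by_parts
    (s s' ρ f : ℝ → ℝ)
    (hs : ∀ t ∈ Set.Icc (-1:ℝ) 1, HasDerivAt s (s' t) t)
    (hs' : ContinuousOn s' (Set.Icc (-1:ℝ) 1))
    (hρ : ContinuousOn ρ (Set.Icc (-1:ℝ) 1))
    (hf : ∀ t ∈ Set.Icc (-1:ℝ) 1, HasDerivAt f (ρ t) t)
    (x y : ℝ)
    (hden : ∀ t ∈ Set.Icc (-1:ℝ) 1, (x - t)^2 + (y - s t)^2 ≠ 0) :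
    (∫ t in (-1:ℝ)..1,
        (1/2) * Real.log ((x - t)^2 + (y - s t)^2) * ρ t)
    = (1/2) * Real.log ((x - 1)^2 + (y - s 1)^2) * f 1
      - (1/2) * Real.log ((x + 1)^2 + (y - s (-1))^2) * f (-1)
      + ∫ t in (-1:ℝ)..1,
          f t * ((x - t) + (y - s t) * s' t) / ((x - t)^2 + (y - s t)^2) := by
  have hsc : ContinuousOn s (Set.Icc (-1:ℝ) 1) :=
    fun t ht ↦ (hs t ht).continuousAt.continuousWithinAt
  have hI : Set.uIcc (-1:ℝ) 1 = Set.Icc (-1:ℝ) 1 := Set.uIcc_of_le (by norm_num)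
  have hlog : ∀ t ∈ Set.uIcc (-1:ℝ) 1,
      HasDerivAt (fun t ↦ (1/2) * Real.log ((x - t)^2 + (y - s t)^2))
        (-(((x - t) + (y - s t) * s' t) / ((x - t)^2 + (y - s t)^2))) t := by
    intro t ht
    rw [hI] at ht
    have h := (((((hasDerivAt_id t).const_sub x).pow 2).add
      (((hs t ht).const_sub y).pow 2)).log (hden t ht)).const_mul (1/2)
    refine h.congr_deriv ?_
    have hd := hden t ht
    simp only [id, Pi.add_apply, Pi.pow_apply]
    field_simp
    ring
  have hcont : ContinuousOn
      (fun t ↦ -(((x - t) + (y - s t) * s' t) / ((x - t)^2 + (y - s t)^2)))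
      (Set.Icc (-1:ℝ) 1) :=
    (ContinuousOn.div (by fun_prop) (by fun_prop) hden).neg
  rw [intervalIntegral.integral_mul_deriv_eq_deriv_mul hlog (fun t ht ↦ hf t (hI ▸ ht))
    (hI ▸ hcont).intervalIntegrable (hI ▸ hρ).intervalIntegrable, sub_eq_add_neg,
    ← intervalIntegral.integral_neg, sub_neg_eq_add]
  congr 1
  refine intervalIntegral.integral_congr fun t _ ↦ ?_
  ring
end

section
/- Let p < 0 be a real number and let w ∈ ℂ satisfy -1 < Re w < 1 and Im w < 0. Then ∫_{-1}^{1} e^{i p x} / (x - w) dx = -2πi·e^{i p w} + i·∫_{0}^{∞} e^{i p (1 - it)} / (1 - it - w) dt - i·∫_{0}^{∞} e^{i p (-1 - it)} / (-1 - it - w) dt. -/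
open MeasureTheory Complex

lemma log_neg_I_mul {v : ℂ} (hr : 0 < v.re) (hi : 0 < v.im) :
    log (-I * v) = log v - Real.pi / 2 * I := by
  have hv : v ≠ 0 := by rintro rfl; simp at hr
  have h1 : 0 ≤ v.arg := arg_nonneg_iff.2 hi.le
  have h2 : v.arg ≤ Real.pi := arg_le_pi v
  have hp := Real.pi_pos
  rw [log_mul (by simp) hv (by rw [arg_neg_I]; constructor <;> linarith), log_neg_I]
  ring

/-- Integral of `1 / (z - w)` along a segment `t ↦ α * t + β` on which `c * (z - w)` stays in the
slit plane. -/
lemma integral_inv_affine {a b : ℝ} {α β c w : ℂ} (hc : c ≠ 0)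
    (h : ∀ t ∈ Set.uIcc a b, c * (α * t + β - w) ∈ slitPlane) :
    α * ∫ t in a..b, (α * (t : ℂ) + β - w)⁻¹ =
      log (c * (α * b + β - w)) - log (c * (α * a + β - w)) := by
  have hne : ∀ t ∈ Set.uIcc a b, α * (t : ℂ) + β - w ≠ 0 := fun t ht h0 =>
    slitPlane_ne_zero (h t ht) (by rw [h0, mul_zero])
  rw [← intervalIntegral.integral_const_mul]
  refine intervalIntegral.integral_eq_sub_of_hasDerivAt
    (f := fun t : ℝ => log (c * (α * (t : ℂ) + β - w))) (fun t ht => ?_) ?_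
  · have h1 : HasDerivAt (fun t : ℝ => c * (α * (t : ℂ) + β - w)) (c * α) t := by
      have := (((((hasDerivAt_id (t : ℂ)).const_mul α).add_const β).sub_const w).const_mul
        c).comp_ofReal
      simpa using this
    simpa only [mul_div_mul_left _ _ hc, div_eq_mul_inv] using h1.clog_real (h t ht)
  · refine ContinuousOn.intervalIntegrable ?_
    exact continuousOn_const.mul (ContinuousOn.inv₀ (by fun_prop) hne)

/-- The winding number of a rectangle around an interior point. -/
lemma integral_boundary_rect_inv_sub {z₁ z₂ w : ℂ} (h1 : z₁.re < w.re) (h2 : w.re < z₂.re)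
    (h3 : z₁.im < w.im) (h4 : w.im < z₂.im) :
    (∫ x in z₁.re..z₂.re, ((x : ℂ) + z₁.im * I - w)⁻¹)
      - (∫ x in z₁.re..z₂.re, ((x : ℂ) + z₂.im * I - w)⁻¹)
      + I * (∫ y in z₁.im..z₂.im, ((z₂.re : ℂ) + y * I - w)⁻¹)
      - I * (∫ y in z₁.im..z₂.im, ((z₁.re : ℂ) + y * I - w)⁻¹) = 2 * Real.pi * I := by
  have bot := integral_inv_affine (a := z₁.re) (b := z₂.re) (α := 1) (β := z₁.im * I) (c := I)
    (w := w) (by simp) (fun t _ => Or.inl (by simp; linarith))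
  have top := integral_inv_affine (a := z₁.re) (b := z₂.re) (α := 1) (β := z₂.im * I) (c := -I)
    (w := w) (by simp) (fun t _ => Or.inl (by simp; linarith))
  have right := integral_inv_affine (a := z₁.im) (b := z₂.im) (α := I) (β := z₂.re) (c := 1)
    (w := w) (by simp) (fun t _ => Or.inl (by simp; linarith))
  have left := integral_inv_affine (a := z₁.im) (b := z₂.im) (α := I) (β := z₁.re) (c := -1)
    (w := w) (by simp) (fun t _ => Or.inl (by simp; linarith))
  have tr := log_neg_I_mul (v := (z₂.re : ℂ) + z₂.im * I - w) (by simp; linarith)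
    (by simp; linarith)
  have tl := log_neg_I_mul (v := -I * ((z₁.re : ℂ) + z₂.im * I - w)) (by simp; linarith)
    (by simp; linarith)
  have bl := log_neg_I_mul (v := -((z₁.re : ℂ) + z₁.im * I - w)) (by simp; linarith)
    (by simp; linarith)
  have br := log_neg_I_mul (v := I * ((z₂.re : ℂ) + z₁.im * I - w)) (by simp; linarith)
    (by simp; linarith)
  simp only [← mul_assoc, neg_mul, I_mul_I, mul_neg, neg_neg, one_mul] at *
  simp only [mul_comm I (ofReal _), add_comm (ofReal _ * I) (ofReal _)] at *
  rw [bot, top, right, left, tr, tl, br, bl]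
  ring

/-- **Cauchy integral formula** on a rectangle for an entire function. -/
lemma integral_boundary_rect_div_sub {f : ℂ → ℂ} (hf : Differentiable ℂ f) {z₁ z₂ w : ℂ}
    (h1 : z₁.re < w.re) (h2 : w.re < z₂.re) (h3 : z₁.im < w.im) (h4 : w.im < z₂.im) :
    (∫ x in z₁.re..z₂.re, f (x + z₁.im * I) / ((x : ℂ) + z₁.im * I - w))
      - (∫ x in z₁.re..z₂.re, f (x + z₂.im * I) / ((x : ℂ) + z₂.im * I - w))
      + I * (∫ y in z₁.im..z₂.im, f (z₂.re + y * I) / ((z₂.re : ℂ) + y * I - w))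
      - I * (∫ y in z₁.im..z₂.im, f (z₁.re + y * I) / ((z₁.re : ℂ) + y * I - w)) =
      2 * Real.pi * I * f w := by
  have hg : Differentiable ℂ (dslope f w) := by
    rw [← differentiableOn_univ] at hf ⊢
    exact (differentiableOn_dslope Filter.univ_mem).2 hf
  have hgc := hg.continuous
  have key := integral_boundary_rect_eq_zero_of_differentiableOn (dslope f w) z₁ z₂
    hg.differentiableOn
  have seg : ∀ (γ : ℝ → ℂ) (a b : ℝ), Continuous γ → (∀ t, γ t ≠ w) →
      ∫ t in a..b, f (γ t) / (γ t - w) =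
        (∫ t in a..b, dslope f w (γ t)) + f w * ∫ t in a..b, (γ t - w)⁻¹ := by
    intro γ a b hγ hne
    have hi : Continuous fun t => (γ t - w)⁻¹ :=
      (hγ.sub continuous_const).inv₀ fun t => sub_ne_zero.2 (hne t)
    rw [← intervalIntegral.integral_const_mul, ← intervalIntegral.integral_add
      (Continuous.intervalIntegrable (by fun_prop) _ _)
      (Continuous.intervalIntegrable (by fun_prop) _ _)]
    refine intervalIntegral.integral_congr fun t _ => ?_
    have := sub_ne_zero.2 (hne t)
    simp only [dslope_of_ne f (hne t), slope_def_field]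
    field_simp
    ring
  rw [seg (fun x => x + z₁.im * I) _ _ (by fun_prop) fun t h => by
      have := congrArg im h; simp at this; linarith,
    seg (fun x => x + z₂.im * I) _ _ (by fun_prop) fun t h => by
      have := congrArg im h; simp at this; linarith,
    seg (fun y => z₂.re + y * I) _ _ (by fun_prop) fun t h => by
      have := congrArg re h; simp at this; linarith,
    seg (fun y => z₁.re + y * I) _ _ (by fun_prop) fun t h => by
      have := congrArg re h; simp at this; linarith]
  simp only [smul_eq_mul] at key
  linear_combination key + f w * integral_boundary_rect_inv_sub h1 h2 h3 h4

lemma norm_exp_I_mul (p : ℝ) (z : ℂ) : ‖exp (I * p * z)‖ = Real.exp (-(p * z.im)) := by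
  rw [norm_exp]
  simp

lemma integrableOn_exp_vertical {p : ℝ} (hp : p < 0) {a : ℝ} {w : ℂ} (ha : w.re ≠ a) :
    IntegrableOn (fun t : ℝ => exp (I * p * (a - I * t)) / (a - I * t - w)) (Set.Ioi 0) := by
  have hne : ∀ t : ℝ, (a : ℂ) - I * t - w ≠ 0 := fun t h => by
    have := congrArg re h
    simp at this
    exact ha (by linarith)
  have hc : Continuous fun t : ℝ => exp (I * p * (a - I * t)) / (a - I * t - w) :=
    Continuous.div (by fun_prop) (by fun_prop) hne
  refine Integrable.mono' ((integrableOn_exp_mul_Ioi hp 0).div_const |a - w.re|)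
    hc.aestronglyMeasurable (Filter.Eventually.of_forall fun t => ?_)
  rw [norm_div, norm_exp_I_mul]
  have h1 : |a - w.re| ≤ ‖(a : ℂ) - I * t - w‖ := by
    simpa using abs_re_le_norm ((a : ℂ) - I * t - w)
  have h0 : 0 < |a - w.re| := abs_pos.2 (sub_ne_zero.2 ha.symm)
  have h2 : -(p * ((a : ℂ) - I * t).im) = p * t := by simp
  rw [h2]
  gcongr

lemma tendsto_integral_exp_horizontal {p : ℝ} (hp : p < 0) (a b : ℝ) (w : ℂ) :
    Filter.Tendsto (fun T : ℝ => ∫ x in a..b,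
      exp (I * p * (x + (-T : ℝ) * I)) / ((x : ℂ) + (-T : ℝ) * I - w)) Filter.atTop (nhds 0) := by
  have hlim : Filter.Tendsto (fun T : ℝ => Real.exp (p * T) * |b - a|) Filter.atTop (nhds 0) := by
    simpa using (Real.tendsto_exp_atBot.comp
      (Filter.tendsto_id.const_mul_atTop_of_neg hp)).mul_const |b - a|
  refine squeeze_zero_norm' ?_ hlim
  filter_upwards [Filter.eventually_ge_atTop (1 - w.im)] with T hT
  refine intervalIntegral.norm_integral_le_of_norm_le_const fun x _ => ?_
  rw [norm_div, norm_exp_I_mul]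
  have h1 : 1 ≤ ‖(x : ℂ) + (-T : ℝ) * I - w‖ := by
    refine le_trans ?_ (abs_im_le_norm _)
    rw [le_abs]
    right
    simp
    linarith
  have h2 : -(p * ((x : ℂ) + (-T : ℝ) * I).im) = p * T := by simp
  rw [h2]
  exact div_le_self (Real.exp_pos _).le h1

/-- The infinite-depth residue theorem identity for the negative
Fourier modes on a flat boundary. -/
theorem flat_negative_mode_identity
    (p : ℝ) (hp : p < 0) (w : ℂ)
    (hre : -1 < w.re ∧ w.re < 1) (him : w.im < 0) :
    (∫ x in (-1:ℝ)..1, Complex.exp (Complex.I * p * x) / ((x : ℂ) - w))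
    = -(2 * Real.pi * Complex.I) * Complex.exp (Complex.I * p * w)
      + Complex.I * (∫ t in Set.Ioi (0:ℝ),
          Complex.exp (Complex.I * p * (1 - Complex.I * t))
            / (1 - Complex.I * t - w))
      - Complex.I * (∫ t in Set.Ioi (0:ℝ),
          Complex.exp (Complex.I * p * (-1 - Complex.I * t))
            / (-1 - Complex.I * t - w)) := by
  have lim : ∀ a : ℝ, w.re ≠ a → Filter.Tendsto (fun T : ℝ => ∫ y in (-T)..0,
      exp (I * p * (a + y * I)) / ((a : ℂ) + y * I - w)) Filter.atTop
      (nhds (∫ t in Set.Ioi (0 : ℝ), exp (I * p * (a - I * t)) / (a - I * t - w))) := by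
    intro a ha
    refine (intervalIntegral_tendsto_integral_Ioi 0 (integrableOn_exp_vertical hp ha)
      Filter.tendsto_id).congr fun T => ?_
    have := intervalIntegral.integral_comp_neg (a := 0) (b := T)
      (fun y : ℝ => exp (I * p * (a + y * I)) / ((a : ℂ) + y * I - w))
    rw [neg_zero] at this
    rw [← this]
    refine intervalIntegral.integral_congr fun t _ => ?_
    have e : (a : ℂ) - I * t = a + (-t : ℝ) * I := by push_cast; ring
    simp only [e]
  have hd : Differentiable ℂ fun z : ℂ => exp (I * p * z) := by fun_prop
  have key : Filter.Tendsto (fun _ : ℝ => 2 * Real.pi * I * exp (I * p * w)) Filter.atTop _ :=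
    ((((tendsto_integral_exp_horizontal hp (-1) 1 w).sub_const
      (∫ x in (-1:ℝ)..1, exp (I * p * x) / ((x : ℂ) - w))).add
      ((lim 1 hre.2.ne).const_mul I)).sub ((lim (-1) hre.1.ne').const_mul I)).congr' <| by
    filter_upwards [Filter.eventually_gt_atTop (-w.im)] with T hT
    have := integral_boundary_rect_div_sub hd (z₁ := ⟨-1, -T⟩) (z₂ := ⟨1, 0⟩) (w := w)
      hre.1 hre.2 (by simpa using neg_lt.1 hT) him
    simpa using this
  have := tendsto_nhds_unique key tendsto_const_nhds
  push_cast at this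
  linear_combination -this
end
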